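/- arXiv:1109.2934 — 3 statements merged into one kernel-verified Lean document; each statement's English description precedes it below -/
import Mathlib

section
/- Let ε > 0 and let f : 𝕋 → [0,1] be measurable. Then there exist a positive integer n and a set A ⊆ 𝕋 that is a finite union of dyadic intervals I_{n,j} = [(j−1)/2^n, j/2^n), j ∈ {1,…,2^n}, such that ‖f − 1_A‖_{U²} ≤ ε. -/
open MeasureTheory
noncomputable section

/-- The Gowers `U²` norm of `f : 𝕋 → ℂ`, with respect to the Haar probability
measure on `𝕋⁴` (the product of the Haar probability measures on `𝕋`). -/
def U2T (f : UnitAddCircle → ℂ) : ℝ :=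
  (∫ z : Fin 4 → UnitAddCircle,
      f (z 0 + z 2) * (starRingEnd ℂ) (f (z 0 + z 3)) *
        (starRingEnd ℂ) (f (z 1 + z 2)) * f (z 1 + z 3)).re ^ ((1 : ℝ) / 4)

/-- The interval `[j/2ⁿ, (j+1)/2ⁿ)` viewed inside the circle `ℝ/ℤ`;
as `j` ranges over `{0, …, 2ⁿ - 1}` these are exactly the dyadic intervals
`I_{n,j} = [(j-1)/2ⁿ, j/2ⁿ)`, `j ∈ {1, …, 2ⁿ}`. -/
def dyadic (n j : ℕ) : Set UnitAddCircle :=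
  (fun r : ℝ => (r : UnitAddCircle)) '' Set.Ico ((j : ℝ) / 2 ^ n) (((j : ℝ) + 1) / 2 ^ n)

section RandomSubset

variable {ι : Type*} [Fintype ι] [DecidableEq ι]

/-- The probability of `S` when each `i : ι` is selected independently with probability `p i`. -/
def subsetWeight (p : ι → ℝ) (S : Finset ι) : ℝ :=
  ∏ i, if i ∈ S then p i else 1 - p i

lemma subsetWeight_nonneg {p : ι → ℝ} (hp : ∀ i, p i ∈ Set.Icc (0 : ℝ) 1) (S : Finset ι) :
    0 ≤ subsetWeight p S := by
  refine Finset.prod_nonneg fun i _ => ?_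
  split_ifs
  · exact (hp i).1
  · exact sub_nonneg.2 (hp i).2

lemma sum_subsetWeight (p : ι → ℝ) : ∑ S, subsetWeight p S = 1 := by
  have h := Finset.prod_add p (fun i => 1 - p i) Finset.univ
  simp only [add_sub_cancel, Finset.prod_const_one, Finset.powerset_univ] at h
  rw [h]
  refine Finset.sum_congr rfl fun S _ => ?_
  rw [subsetWeight, Finset.prod_ite]
  congr 2 <;> ext i <;> simp

lemma sum_subsetWeight_mul_centered (p : ι → ℝ) (i : ι) (R : Finset ι → ℝ)
    (hR : ∀ S, R (symmDiff S {i}) = R S) :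
    ∑ S, subsetWeight p S * ((p i - if i ∈ S then 1 else 0) * R S) = 0 := by
  refine Finset.sum_involution (fun S _ => symmDiff S {i}) (fun S _ => ?_) (fun S _ _ h => ?_)
    (fun _ _ => Finset.mem_univ _) (fun S _ => ?_)
  · have hrest : ∏ j ∈ Finset.univ.erase i, (if j ∈ symmDiff S {i} then p j else 1 - p j) =
        ∏ j ∈ Finset.univ.erase i, if j ∈ S then p j else 1 - p j := by
      refine Finset.prod_congr rfl fun j hj => ?_
      have hji : j ≠ i := Finset.ne_of_mem_erase hj
      simp [Finset.mem_symmDiff, hji]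
    rw [hR, subsetWeight, subsetWeight, ← Finset.mul_prod_erase _ _ (Finset.mem_univ i),
      ← Finset.mul_prod_erase Finset.univ (fun j => if j ∈ symmDiff S {i} then p j else 1 - p j)
        (Finset.mem_univ i), hrest]
    by_cases hi : i ∈ S <;> simp [Finset.mem_symmDiff, hi] <;> ring
  · have h' := symmDiff_eq_left.1 h
    simp at h'
  · exact symmDiff_symmDiff_cancel_right _ _

lemma abs_sum_subsetWeight_mul_le {p : ι → ℝ} (hp : ∀ i, p i ∈ Set.Icc (0 : ℝ) 1)
    {R : Finset ι → ℝ} {M : ℝ} (hM : ∀ S, |R S| ≤ M) :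
    |∑ S, subsetWeight p S * R S| ≤ M := by
  calc |∑ S, subsetWeight p S * R S| ≤ ∑ S, subsetWeight p S * M := by
        refine (Finset.abs_sum_le_sum_abs _ _).trans (Finset.sum_le_sum fun S _ => ?_)
        rw [abs_mul, abs_of_nonneg (subsetWeight_nonneg hp S)]
        exact mul_le_mul_of_nonneg_left (hM S) (subsetWeight_nonneg hp S)
    _ = M := by rw [← Finset.sum_mul, sum_subsetWeight, one_mul]

lemma abs_sum_subsetWeight_mul_sub_le {p : ι → ℝ} (hp : ∀ i, p i ∈ Set.Icc (0 : ℝ) 1) (i : ι)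
    (t : ℝ) {R : Finset ι → ℝ} (hR : ∀ S, R (symmDiff S {i}) = R S) (hR1 : ∀ S, |R S| ≤ 1) :
    |∑ S, subsetWeight p S * ((t - if i ∈ S then 1 else 0) * R S)| ≤ |t - p i| := by
  have h : ∑ S, subsetWeight p S * ((t - if i ∈ S then 1 else 0) * R S) =
      (t - p i) * ∑ S, subsetWeight p S * R S := by
    rw [← sub_eq_zero, Finset.mul_sum, ← Finset.sum_sub_distrib]
    refine Eq.trans ?_ (sum_subsetWeight_mul_centered p i R hR)
    exact Finset.sum_congr rfl fun S _ => by ring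
  rw [h, abs_mul]
  exact mul_le_of_le_one_right (abs_nonneg _) (abs_sum_subsetWeight_mul_le hp hR1)

end RandomSubset

section Circle

local notation "𝕋" => UnitAddCircle

instance isProbabilityMeasure_volume_unitAddCircle :
    IsProbabilityMeasure (volume : Measure 𝕋) :=
  ⟨UnitAddCircle.measure_univ⟩

instance isAddHaarMeasure_volume_prod {G H : Type*} [AddGroup G] [TopologicalSpace G]
    [MeasureSpace G] [AddGroup H] [TopologicalSpace H] [MeasureSpace H]
    [SFinite (volume : Measure G)] [SFinite (volume : Measure H)]
    [MeasurableAdd G] [MeasurableAdd H]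
    [Measure.IsAddHaarMeasure (volume : Measure G)]
    [Measure.IsAddHaarMeasure (volume : Measure H)] :
    Measure.IsAddHaarMeasure (volume : Measure (G × H)) :=
  Measure.prod.instIsAddHaarMeasure _ _

/-- The average of a function over additive quadruples, in the real case. -/
def quadAverage (g : 𝕋 → ℝ) : ℝ :=
  ∫ z : Fin 4 → 𝕋, g (z 0 + z 2) * g (z 0 + z 3) * g (z 1 + z 2) * g (z 1 + z 3)

lemma quad_abs_le_one {g : 𝕋 → ℝ} (hg : ∀ x, |g x| ≤ 1) (a b c d : 𝕋) :
    |g a * g b * g c * g d| ≤ 1 := by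
  simp only [abs_mul]
  exact mul_le_one₀ (mul_le_one₀ (mul_le_one₀ (hg _) (abs_nonneg _) (hg _)) (abs_nonneg _) (hg _))
    (abs_nonneg _) (hg _)

lemma integrable_of_abs_le {α : Type*} [MeasurableSpace α] {μ : Measure α} [IsFiniteMeasure μ]
    {g : α → ℝ} (hm : Measurable g) (M : ℝ) (hg : ∀ x, |g x| ≤ M) : Integrable g μ :=
  Integrable.of_bound hm.aestronglyMeasurable M (Filter.Eventually.of_forall hg)

lemma quadAverage_nonneg {g : 𝕋 → ℝ} (hm : Measurable g) (hg : ∀ x, |g x| ≤ 1) :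
    0 ≤ quadAverage g := by
  let φ : (Fin 4 → 𝕋) →+ (𝕋 × 𝕋) × (𝕋 × 𝕋) :=
    AddMonoidHom.mk' (fun z => ((z 2, z 3), (z 0, z 1))) fun _ _ => rfl
  have hφ : MeasurePreserving φ volume volume := by
    have : Measure.IsAddHaarMeasure (volume : Measure ((𝕋 × 𝕋) × (𝕋 × 𝕋))) :=
      isAddHaarMeasure_volume_prod
    refine φ.measurePreserving (by simp only [φ, AddMonoidHom.mk'_apply]; fun_prop) ?_ (by simp)
    rintro ⟨⟨a, b⟩, c, d⟩
    exact ⟨![c, d, a, b], rfl⟩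
  let G : (𝕋 × 𝕋) × (𝕋 × 𝕋) → ℝ := fun w =>
    (g (w.2.1 + w.1.1) * g (w.2.1 + w.1.2)) * (g (w.2.2 + w.1.1) * g (w.2.2 + w.1.2))
  have hG : Measurable G := by fun_prop
  have hGi : Integrable G volume := integrable_of_abs_le hG 1 fun w => by
    simpa [G, mul_assoc] using quad_abs_le_one hg (w.2.1 + w.1.1) (w.2.1 + w.1.2)
      (w.2.2 + w.1.1) (w.2.2 + w.1.2)
  have h : quadAverage g = ∫ w, G w := by
    rw [← hφ.map_eq, integral_map hφ.aemeasurable hG.aestronglyMeasurable]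
    refine integral_congr_ae (Filter.Eventually.of_forall fun z => ?_)
    simp only [G, φ, AddMonoidHom.mk'_apply]
    ring
  rw [h, Measure.volume_eq_prod, integral_prod _ hGi]
  refine integral_nonneg fun y => ?_
  simp only [G]
  rw [Measure.volume_eq_prod,
    integral_prod_mul (fun x => g (x + y.1) * g (x + y.2)) (fun x => g (x + y.1) * g (x + y.2))]
  exact mul_self_nonneg _

lemma integral_collision_le {ι : Type*} [DecidableEq ι] [MeasurableSpace ι] [Countable ι]
    [MeasurableSingletonClass ι]
    {c : 𝕋 → ι} (hc : Measurable c) {δ : ℝ} (hδ : ∀ i, volume.real (c ⁻¹' {i}) ≤ δ)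
    (φ : (Fin 4 → 𝕋) →+ 𝕋 × 𝕋) (hφc : Continuous φ) (hφs : Function.Surjective φ) :
    ∫ z, (if c (φ z).1 = c (φ z).2 then 1 else 0 : ℝ) ≤ δ := by
  have hφ : MeasurePreserving φ volume volume := φ.measurePreserving hφc hφs (by simp)
  let K : 𝕋 × 𝕋 → ℝ := fun w => if c w.1 = c w.2 then 1 else 0
  have hK : Measurable K := Measurable.ite
    (measurableSet_eq_fun (hc.comp measurable_fst) (hc.comp measurable_snd))
    measurable_const measurable_const
  have hKi : Integrable K volume := integrable_of_abs_le hK 1 fun w => by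
    simp only [K]; split_ifs <;> simp
  calc ∫ z, (if c (φ z).1 = c (φ z).2 then 1 else 0 : ℝ) = ∫ w, K w := by
        rw [← hφ.map_eq, integral_map hφ.aemeasurable hK.aestronglyMeasurable]
    _ = ∫ s, ∫ t, K (s, t) := by rw [Measure.volume_eq_prod, integral_prod _ hKi]
    _ ≤ ∫ _ : 𝕋, δ := by
        refine integral_mono hKi.integral_prod_left (integrable_const _) fun s => ?_
        have : ∀ t, K (s, t) = (c ⁻¹' {c s}).indicator (1 : 𝕋 → ℝ) t := fun t => by
          by_cases h : c t = c s
          · simp [K, h]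
          · simp [K, h, Ne.symm h]
        simp only [this]
        rw [integral_indicator_one (hc (measurableSet_singleton _))]
        exact hδ _
    _ = δ := by simp

lemma exists_quadAverage_le {ι : Type*} [Fintype ι] [DecidableEq ι] [MeasurableSpace ι]
    [MeasurableSingletonClass ι] {c : 𝕋 → ι} (hc : Measurable c) {δ : ℝ}
    (hδ : ∀ i, volume.real (c ⁻¹' {i}) ≤ δ) {p : ι → ℝ} (hp : ∀ i, p i ∈ Set.Icc (0 : ℝ) 1)
    {f : 𝕋 → ℝ} (hf : Measurable f) (hf01 : ∀ x, f x ∈ Set.Icc (0 : ℝ) 1) :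
    ∃ S : Finset ι, quadAverage (fun x => f x - if c x ∈ S then 1 else 0) ≤
      3 * δ + ∫ x, |f x - p (c x)| := by
  let g : Finset ι → 𝕋 → ℝ := fun S x => f x - if c x ∈ S then 1 else 0
  have hg : ∀ S, Measurable (g S) := fun S => hf.sub <| Measurable.ite
    (hc S.measurableSet) measurable_const measurable_const
  have hg1 : ∀ S x, |g S x| ≤ 1 := fun S x => by
    have := hf01 x
    simp only [g, abs_le]
    split_ifs <;> constructor <;> linarith [this.1, this.2]
  let Q : Finset ι → (Fin 4 → 𝕋) → ℝ := fun S z =>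
    g S (z 0 + z 2) * g S (z 0 + z 3) * g S (z 1 + z 2) * g S (z 1 + z 3)
  have hQi : ∀ S, Integrable (Q S) volume := fun S =>
    integrable_of_abs_le (by have := hg S; fun_prop) 1 fun z => quad_abs_le_one (hg1 S) _ _ _ _
  let K : 𝕋 → 𝕋 → ℝ := fun a b => if c a = c b then 1 else 0
  have hK0 : ∀ a b, 0 ≤ K a b := fun a b => by simp only [K]; split_ifs <;> simp
  have hK : ∀ u v : (Fin 4 → 𝕋) → 𝕋, Measurable u → Measurable v →
      Integrable (fun z => K (u z) (v z)) volume := fun u v hu hv =>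
    integrable_of_abs_le (Measurable.ite (measurableSet_eq_fun (hc.comp hu) (hc.comp hv))
      measurable_const measurable_const) 1 fun w => by simp only [K]; split_ifs <;> simp
  have hpm : Measurable fun x => |f x - p (c x)| :=
    (hf.sub ((measurable_of_countable p).comp hc)).abs
  have hpoint : ∀ z, ∑ S, subsetWeight p S * Q S z ≤
      K (z 0 + z 2) (z 0 + z 3) + K (z 0 + z 2) (z 1 + z 2) + K (z 0 + z 2) (z 1 + z 3) +
        |f (z 0 + z 2) - p (c (z 0 + z 2))| := by
    intro z
    generalize hA : z 0 + z 2 = A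
    generalize hB : z 0 + z 3 = B
    generalize hC : z 1 + z 2 = C
    generalize hD : z 1 + z 3 = D
    simp only [Q, hA, hB, hC, hD]
    have hB0 := hK0 A B
    have hC0 := hK0 A C
    have hD0 := hK0 A D
    by_cases hcol : c A = c B ∨ c A = c C ∨ c A = c D
    · have h1 := (abs_le.1 (abs_sum_subsetWeight_mul_le hp
        fun S => quad_abs_le_one (hg1 S) A B C D)).2
      have h2 : 1 ≤ K A B + K A C + K A D := by
        rcases hcol with h | h | h
        · have : K A B = 1 := if_pos h
          linarith
        · have : K A C = 1 := if_pos h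
          linarith
        · have : K A D = 1 := if_pos h
          linarith
      linarith [abs_nonneg (f A - p (c A))]
    · push Not at hcol
      have hinv : ∀ S X, c A ≠ c X → g (symmDiff S {c A}) X = g S X := fun S X h => by
        simp [g, Finset.mem_symmDiff, h.symm]
      have h1 := abs_sum_subsetWeight_mul_sub_le hp (c A) (f A)
        (R := fun S => g S B * g S C * g S D)
        (fun S => by simp only [hinv S B hcol.1, hinv S C hcol.2.1, hinv S D hcol.2.2])
        (fun S => by
          simp only [abs_mul]
          exact mul_le_one₀ (mul_le_one₀ (hg1 _ _) (abs_nonneg _) (hg1 _ _)) (abs_nonneg _)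
            (hg1 _ _))
      have h2 : ∀ S, g S A * g S B * g S C * g S D =
          (f A - if c A ∈ S then 1 else 0) * (g S B * g S C * g S D) := fun S => by
        simp only [g]; ring
      simp only [h2]
      linarith [(abs_le.1 h1).2]
  let pair (i j k l : Fin 4) : (Fin 4 → 𝕋) →+ 𝕋 × 𝕋 :=
    AddMonoidHom.mk' (fun z => (z i + z j, z k + z l)) fun x y => by
      simp only [Pi.add_apply, Prod.mk_add_mk, Prod.mk.injEq]
      constructor <;> abel
  have hpair : ∀ i j k l, Continuous (pair i j k l) := fun i j k l => by
    simp only [pair, AddMonoidHom.mk'_apply]; fun_prop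
  have e1 : ∫ z : Fin 4 → 𝕋, K (z 0 + z 2) (z 0 + z 3) ≤ δ :=
    integral_collision_le hc hδ (pair 0 2 0 3) (hpair _ _ _ _) fun w =>
      ⟨![0, 0, w.1, w.2], by simp [pair]⟩
  have e2 : ∫ z : Fin 4 → 𝕋, K (z 0 + z 2) (z 1 + z 2) ≤ δ :=
    integral_collision_le hc hδ (pair 0 2 1 2) (hpair _ _ _ _) fun w =>
      ⟨![w.1, w.2, 0, 0], by simp [pair]⟩
  have e3 : ∫ z : Fin 4 → 𝕋, K (z 0 + z 2) (z 1 + z 3) ≤ δ :=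
    integral_collision_le hc hδ (pair 0 2 1 3) (hpair _ _ _ _) fun w =>
      ⟨![w.1, w.2, 0, 0], by simp [pair]⟩
  let φ : (Fin 4 → 𝕋) →+ 𝕋 := AddMonoidHom.mk' (fun z => z 0 + z 2) fun x y => by
    simp only [Pi.add_apply]; abel
  have hφ : MeasurePreserving φ volume volume := by
    refine φ.measurePreserving (by simp only [φ, AddMonoidHom.mk'_apply]; fun_prop) ?_ (by simp)
    exact fun x => ⟨![x, 0, 0, 0], by simp [φ]⟩
  have e4 : ∫ z : Fin 4 → 𝕋, |f (z 0 + z 2) - p (c (z 0 + z 2))| = ∫ x, |f x - p (c x)| := by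
    conv_rhs => rw [← hφ.map_eq, integral_map hφ.aemeasurable hpm.aestronglyMeasurable]
    rfl
  have i4 : Integrable (fun z : Fin 4 → 𝕋 => |f (z 0 + z 2) - p (c (z 0 + z 2))|) volume :=
    integrable_of_abs_le (hpm.comp (by fun_prop : Measurable fun z : Fin 4 → 𝕋 => z 0 + z 2)) 1
      fun z => by
        have h1 := hf01 (z 0 + z 2)
        have h2 := hp (c (z 0 + z 2))
        rw [abs_abs, abs_le]
        constructor <;> linarith [h1.1, h1.2, h2.1, h2.2]
  have i1 := hK (fun z => z 0 + z 2) (fun z => z 0 + z 3) (by fun_prop) (by fun_prop)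
  have i2 := hK (fun z => z 0 + z 2) (fun z => z 1 + z 2) (by fun_prop) (by fun_prop)
  have i3 := hK (fun z => z 0 + z 2) (fun z => z 1 + z 3) (by fun_prop) (by fun_prop)
  have hmean : ∑ S, subsetWeight p S * quadAverage (g S) ≤ 3 * δ + ∫ x, |f x - p (c x)| :=
    calc ∑ S, subsetWeight p S * quadAverage (g S)
        = ∫ z, ∑ S, subsetWeight p S * Q S z := by
          rw [integral_finsetSum _ fun S _ => (hQi S).const_mul _]
          simp only [integral_const_mul]
          rfl
      _ ≤ ∫ z : Fin 4 → 𝕋, (K (z 0 + z 2) (z 0 + z 3) + K (z 0 + z 2) (z 1 + z 2) +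
            K (z 0 + z 2) (z 1 + z 3) + |f (z 0 + z 2) - p (c (z 0 + z 2))|) :=
          integral_mono (integrable_finsetSum _ fun S _ => (hQi S).const_mul _)
            (((i1.add i2).add i3).add i4) hpoint
      _ ≤ 3 * δ + ∫ x, |f x - p (c x)| := by
          have h4 := integral_add ((i1.add i2).add i3) i4
          have h3 := integral_add (i1.add i2) i3
          have h2 := integral_add i1 i2
          simp only [Pi.add_apply] at h2 h3 h4
          rw [h4, h3, h2, e4]
          linarith
  by_contra! hlt
  have hpos : ∃ S, 0 < subsetWeight p S := by
    by_contra! h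
    linarith [sum_subsetWeight p, Finset.sum_nonpos fun S (_ : S ∈ Finset.univ) => h S]
  obtain ⟨S₀, hS₀⟩ := hpos
  have : ∑ S, subsetWeight p S * (3 * δ + ∫ x, |f x - p (c x)|) <
      ∑ S, subsetWeight p S * quadAverage (g S) :=
    Finset.sum_lt_sum
      (fun S _ => mul_le_mul_of_nonneg_left (hlt S).le (subsetWeight_nonneg hp S))
      ⟨S₀, Finset.mem_univ _, mul_lt_mul_of_pos_left (hlt S₀) hS₀⟩
  rw [← Finset.sum_mul, sum_subsetWeight, one_mul] at this
  linarith

/-- The index of the dyadic interval of level `n` that contains `x`. -/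
def dyadicIndex (n : ℕ) (x : 𝕋) : Fin (2 ^ n) :=
  ⟨⌊(2 : ℝ) ^ n * (AddCircle.equivIco 1 0 x : ℝ)⌋₊, by
    have hx := (AddCircle.equivIco 1 0 x).2
    rw [Nat.floor_lt (mul_nonneg (by positivity) hx.1)]
    push_cast
    have h2 : (AddCircle.equivIco 1 0 x : ℝ) < 1 := hx.2.trans_eq (zero_add 1)
    exact mul_lt_of_lt_one_right (by positivity) h2⟩

lemma dyadicIndex_eq_iff (n : ℕ) (x : 𝕋) (j : Fin (2 ^ n)) :
    dyadicIndex n x = j ↔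
      (AddCircle.equivIco 1 0 x : ℝ) ∈ Set.Ico ((j : ℝ) / 2 ^ n) (((j : ℝ) + 1) / 2 ^ n) := by
  have hx := (AddCircle.equivIco 1 0 x).2
  have h2 : (0 : ℝ) < 2 ^ n := by positivity
  rw [Fin.ext_iff, dyadicIndex, Nat.floor_eq_iff (mul_nonneg h2.le hx.1), Set.mem_Ico,
    div_le_iff₀' h2, lt_div_iff₀' h2]

lemma Ico_dyadic_subset (n : ℕ) (j : Fin (2 ^ n)) :
    Set.Ico ((j : ℝ) / 2 ^ n) (((j : ℝ) + 1) / 2 ^ n) ⊆ Set.Ico 0 (0 + 1) := by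
  have h2 : (0 : ℝ) < 2 ^ n := by positivity
  have hj : (j : ℝ) + 1 ≤ 2 ^ n := by exact_mod_cast j.2
  rw [zero_add]
  exact Set.Ico_subset_Ico (by positivity) ((div_le_one h2).2 hj)

lemma mem_dyadic_iff (n : ℕ) (x : 𝕋) (j : Fin (2 ^ n)) :
    x ∈ dyadic n j ↔ dyadicIndex n x = j := by
  rw [dyadicIndex_eq_iff]
  constructor
  · rintro ⟨r, hr, rfl⟩
    rwa [AddCircle.equivIco_coe_of_mem (Ico_dyadic_subset n j hr)]
  · exact fun h => ⟨_, h, AddCircle.coe_equivIco⟩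

lemma measurable_dyadicIndex (n : ℕ) : Measurable (dyadicIndex n) := by
  refine measurable_to_countable' fun j => ?_
  have h : dyadicIndex n ⁻¹' {j} = (fun x : 𝕋 => (AddCircle.equivIco 1 0 x : ℝ)) ⁻¹'
      Set.Ico ((j : ℝ) / 2 ^ n) (((j : ℝ) + 1) / 2 ^ n) :=
    Set.ext fun x => dyadicIndex_eq_iff n x j
  rw [h]
  exact measurable_subtype_coe.comp (AddCircle.measurableEquivIco 1 0).measurable measurableSet_Ico

lemma volume_dyadicIndex_preimage_le (n : ℕ) (j : Fin (2 ^ n)) :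
    volume.real (dyadicIndex n ⁻¹' {j}) ≤ 1 / 2 ^ n := by
  have hm : MeasurableSet (dyadicIndex n ⁻¹' {j}) :=
    measurable_dyadicIndex n (measurableSet_singleton j)
  have hmk := UnitAddCircle.measurePreserving_mk 0
  have h : volume (dyadicIndex n ⁻¹' {j}) ≤ ENNReal.ofReal (1 / 2 ^ n) := by
    rw [← hmk.measure_preimage hm.nullMeasurableSet,
      Measure.restrict_apply (hmk.measurable hm)]
    calc _ ≤ volume (Set.Ico ((j : ℝ) / 2 ^ n) (((j : ℝ) + 1) / 2 ^ n) ∪ {1}) := by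
          refine measure_mono fun r ⟨hr, hr0, hr1⟩ => ?_
          rw [zero_add] at hr1
          rcases hr1.lt_or_eq with h1 | h1
          · left
            have := (dyadicIndex_eq_iff n (r : 𝕋) j).1 hr
            rwa [AddCircle.equivIco_coe_of_mem ⟨hr0.le, by rwa [zero_add]⟩] at this
          · exact Or.inr h1
      _ ≤ _ := by
          refine (measure_union_le _ _).trans ?_
          rw [Real.volume_Ico, Real.volume_singleton, add_zero]
          exact le_of_eq (by congr 1; ring)
  exact ENNReal.toReal_le_of_le_ofReal (by positivity) h

lemma dist_dyadicIndex_le (n : ℕ) (x : 𝕋) :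
    dist x (((dyadicIndex n x : ℕ) : ℝ) / 2 ^ n : ℝ) ≤ 1 / 2 ^ n := by
  obtain ⟨h1, h2⟩ := (dyadicIndex_eq_iff n x _).1 rfl
  rw [add_div] at h2
  generalize (((dyadicIndex n x : ℕ) : ℝ) / 2 ^ n) = t at h1 h2 ⊢
  rw [dist_eq_norm]
  nth_rw 1 [← AddCircle.coe_equivIco (p := (1 : ℝ)) (a := 0) (y := x)]
  rw [← AddCircle.coe_sub]
  refine (QuotientAddGroup.norm_mk_le_norm).trans ?_
  rw [Real.norm_eq_abs, abs_of_nonneg (sub_nonneg.2 h1)]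
  linarith

lemma abs_sub_projIcc_le {t s : ℝ} (ht : t ∈ Set.Icc (0 : ℝ) 1) :
    |t - max 0 (min 1 s)| ≤ |t - s| := by
  obtain ⟨h0, h1⟩ := ht
  rcases max_cases 0 (min 1 s) with ⟨h, h'⟩ | ⟨h, h'⟩ <;>
    rcases min_cases 1 s with ⟨k, k'⟩ | ⟨k, k'⟩ <;>
    rw [h] <;> (try rw [k]) <;> rcases abs_cases (t - s) with ⟨l, l'⟩ | ⟨l, l'⟩ <;>
    rw [abs_le] <;> constructor <;> linarith

/-- Step functions on fine dyadic partitions approximate `f` in `L¹`. -/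
lemma exists_dyadic_step_approx {f : 𝕋 → ℝ} (hf : Measurable f)
    (hf01 : ∀ x, f x ∈ Set.Icc (0 : ℝ) 1) {η : ℝ} (hη : 0 < η) :
    ∃ n₀ : ℕ, ∀ n ≥ n₀, ∃ p : Fin (2 ^ n) → ℝ, (∀ i, p i ∈ Set.Icc (0 : ℝ) 1) ∧
      ∫ x, |f x - p (dyadicIndex n x)| ≤ η := by
  have hfi : Integrable f volume := integrable_of_abs_le hf 1 fun x => by
    rw [abs_of_nonneg (hf01 x).1]; exact (hf01 x).2
  obtain ⟨g, hg, hgi⟩ := hfi.exists_boundedContinuous_integral_sub_le (half_pos hη)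
  obtain ⟨δ, hδ, hgδ⟩ := Metric.uniformContinuous_iff.1
    (CompactSpace.uniformContinuous_of_continuous g.continuous) (η / 2) (half_pos hη)
  obtain ⟨n₀, hn₀⟩ := exists_pow_lt_of_lt_one hδ (by norm_num : (1 / 2 : ℝ) < 1)
  refine ⟨n₀, fun n hn =>
    ⟨fun i => max 0 (min 1 (g (((i : ℕ) : ℝ) / 2 ^ n : ℝ))), fun i => ?_, ?_⟩⟩
  · exact ⟨le_max_left _ _, max_le zero_le_one (min_le_left _ _)⟩
  · have hpt : ∀ x, |f x - max 0 (min 1 (g (((dyadicIndex n x : ℕ) : ℝ) / 2 ^ n : ℝ)))| ≤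
        ‖f x - g x‖ + η / 2 := fun x => by
      have hdist : dist x (((dyadicIndex n x : ℕ) : ℝ) / 2 ^ n : ℝ) < δ := by
        refine (dist_dyadicIndex_le n x).trans_lt (lt_of_le_of_lt ?_ hn₀)
        rw [← one_div_pow]
        exact pow_le_pow_of_le_one (by norm_num) (by norm_num) hn
      have h1 := hgδ hdist
      rw [Real.dist_eq] at h1
      rw [Real.norm_eq_abs]
      linarith [abs_sub_projIcc_le (s := g (((dyadicIndex n x : ℕ) : ℝ) / 2 ^ n : ℝ)) (hf01 x),
        abs_sub_le (f x) (g x) (g (((dyadicIndex n x : ℕ) : ℝ) / 2 ^ n : ℝ))]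
    calc _ ≤ ∫ x, (‖f x - g x‖ + η / 2) :=
          integral_mono_of_nonneg (Filter.Eventually.of_forall fun x => abs_nonneg _)
            ((hfi.sub hgi).norm.add (integrable_const _)) (Filter.Eventually.of_forall hpt)
      _ = (∫ x, ‖f x - g x‖) + η / 2 := by
          have h := integral_add (hfi.sub hgi).norm (integrable_const (η / 2))
          simp only [Pi.sub_apply] at h
          rw [h]
          simp
      _ ≤ η := by linarith

lemma U2T_ofReal (g : 𝕋 → ℝ) :
    U2T (fun x => (g x : ℂ)) = quadAverage g ^ ((1 : ℝ) / 4) := by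
  simp only [U2T, Complex.conj_ofReal, ← Complex.ofReal_mul]
  rw [integral_complex_ofReal, Complex.ofReal_re, quadAverage]

end Circle

/-- any `[0,1]`-valued measurable function on the circle is close in the
`U²` norm to the indicator function of a finite union of dyadic intervals. -/
theorem stmt13 (ε : ℝ) (hε : 0 < ε) (f : UnitAddCircle → ℝ)
    (hmeas : Measurable f) (hrange : ∀ x, f x ∈ Set.Icc (0 : ℝ) 1) :
    ∃ (n : ℕ) (S : Finset (Fin (2 ^ n))),
      U2T (fun x => (f x : ℂ) -
        Set.indicator (⋃ j ∈ S, dyadic n (j : ℕ)) (fun _ => (1 : ℂ)) x) ≤ ε := by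
  obtain ⟨n₀, hn₀⟩ := exists_dyadic_step_approx hmeas hrange (η := ε ^ 4 / 2) (by positivity)
  obtain ⟨n₁, hn₁⟩ := exists_pow_lt_of_lt_one (by positivity : 0 < ε ^ 4 / 6)
    (by norm_num : (1 / 2 : ℝ) < 1)
  obtain ⟨p, hp, hfp⟩ := hn₀ (max n₀ n₁) (le_max_left _ _)
  have hsmall : (1 : ℝ) / 2 ^ max n₀ n₁ ≤ ε ^ 4 / 6 := by
    rw [← one_div_pow]
    exact (pow_le_pow_of_le_one (by norm_num) (by norm_num) (le_max_right _ _)).trans hn₁.le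
  generalize max n₀ n₁ = n at p hp hfp hsmall
  obtain ⟨S, hS⟩ := exists_quadAverage_le (measurable_dyadicIndex n)
    (volume_dyadicIndex_preimage_le n) hp hmeas hrange
  refine ⟨n, S, ?_⟩
  let g : UnitAddCircle → ℝ := fun x => f x - if dyadicIndex n x ∈ S then 1 else 0
  have hg : Measurable g := hmeas.sub <| Measurable.ite
    (measurable_dyadicIndex n S.measurableSet) measurable_const measurable_const
  have hg1 : ∀ x, |g x| ≤ 1 := fun x => by
    have := hrange x
    simp only [g, abs_le]
    split_ifs <;> constructor <;> linarith [this.1, this.2]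
  have hfg : (fun x => (f x : ℂ) -
      Set.indicator (⋃ j ∈ S, dyadic n (j : ℕ)) (fun _ => (1 : ℂ)) x) = fun x => (g x : ℂ) := by
    funext x
    have hx : x ∈ ⋃ j ∈ S, dyadic n (j : ℕ) ↔ dyadicIndex n x ∈ S := by
      simp [mem_dyadic_iff]
    by_cases h : dyadicIndex n x ∈ S <;> simp [g, hx, h]
  have hle : quadAverage g ≤ ε ^ 4 := hS.trans (by linarith)
  rw [hfg, U2T_ofReal]
  calc quadAverage g ^ ((1 : ℝ) / 4) ≤ (ε ^ 4) ^ ((1 : ℝ) / 4) :=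
        Real.rpow_le_rpow (quadAverage_nonneg hg hg1) hle (by norm_num)
    _ = ε := by
        rw [← Real.rpow_natCast, ← Real.rpow_mul hε.le]
        norm_num
end
end

section
/- For every ε > 0 there exists P such that for every prime p ≥ P and every function f : ℤ/p → [0,1] there exists a set A ⊆ ℤ/p such that ‖f − 1_A‖_{U²} ≤ ε. -/
open MeasureTheory
noncomputable section

/-- The Gowers `U²` norm of `f : ℤ/p → ℂ`:
`‖f‖_{U²}⁴ = p^{-4} ∑_{x,x',y,y'} f(x+y) conj(f(x+y')) conj(f(x'+y)) f(x'+y')`. -/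
def U2Z {p : ℕ} [NeZero p] (f : ZMod p → ℂ) : ℝ :=
  ((∑ z : Fin 4 → ZMod p,
      f (z 0 + z 2) * (starRingEnd ℂ) (f (z 0 + z 3)) *
        (starRingEnd ℂ) (f (z 1 + z 2)) * f (z 1 + z 3)) / (p : ℂ) ^ 4).re ^ ((1 : ℝ) / 4)

/-- The sum over all `z : Fin 4 → G` underlying the `U²` norm of a real function, before
normalization. -/
def parallelogramSum {G : Type*} [Add G] [Fintype G] (g : G → ℝ) : ℝ :=
  ∑ z : Fin 4 → G, g (z 0 + z 2) * g (z 0 + z 3) * g (z 1 + z 2) * g (z 1 + z 3)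

theorem parallelogramSum_nonneg {G : Type*} [Add G] [Fintype G] (g : G → ℝ) :
    0 ≤ parallelogramSum g := by
  let e : (Fin 4 → G) ≃ (G × G) × (G × G) :=
    { toFun := fun z => ((z 0, z 1), (z 2, z 3))
      invFun := fun q => ![q.1.1, q.1.2, q.2.1, q.2.2]
      left_inv := fun z => by ext i; fin_cases i <;> rfl
      right_inv := fun q => rfl }
  have h : parallelogramSum g = ∑ q : G × G, (∑ y, g (q.1 + y) * g (q.2 + y)) ^ 2 := by
    refine (Fintype.sum_equiv e _ (fun q => g (q.1.1 + q.2.1) * g (q.1.1 + q.2.2) *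
      g (q.1.2 + q.2.1) * g (q.1.2 + q.2.2)) (fun _ => rfl)).trans ?_
    rw [Fintype.sum_prod_type]
    refine Finset.sum_congr rfl fun q _ => ?_
    rw [sq, Finset.sum_mul_sum, Fintype.sum_prod_type]
    refine Finset.sum_congr rfl fun y _ => Finset.sum_congr rfl fun y' _ => ?_
    ring
  rw [h]
  positivity

theorem U2Z_ofReal {p : ℕ} [NeZero p] (g : ZMod p → ℝ) :
    U2Z (fun x => (g x : ℂ)) = (parallelogramSum g / (p : ℝ) ^ 4) ^ ((1 : ℝ) / 4) := by
  unfold U2Z parallelogramSum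
  simp only [Complex.conj_ofReal]
  congr 1
  exact_mod_cast Complex.ofReal_re _

/-- The probability that independent Bernoulli variables with parameters `f x` take the
values `s x`. -/
def bernoulliWeight {X : Type*} [Fintype X] (f : X → ℝ) (s : X → Bool) : ℝ :=
  ∏ x, if s x then f x else 1 - f x

/-- The error `f - 1_s` made by rounding `f` to `s`. -/
def roundingError {X : Type*} (f : X → ℝ) (s : X → Bool) (x : X) : ℝ :=
  f x - if s x then 1 else 0

theorem abs_roundingError_le_one {X : Type*} {f : X → ℝ} (hf : ∀ x, f x ∈ Set.Icc (0 : ℝ) 1) (s : X → Bool) (x : X) :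
    |roundingError f s x| ≤ 1 := by
  have := (hf x).1
  have := (hf x).2
  unfold roundingError
  rw [abs_le]
  split_ifs <;> constructor <;> linarith

section Rounding

variable {X : Type*} [Fintype X] {f : X → ℝ}

theorem bernoulliWeight_nonneg (hf : ∀ x, f x ∈ Set.Icc (0 : ℝ) 1) (s : X → Bool) :
    0 ≤ bernoulliWeight f s := by
  refine Finset.prod_nonneg fun x _ => ?_
  split_ifs
  · exact (hf x).1
  · linarith [(hf x).2]

theorem sum_bernoulliWeight [DecidableEq X] (f : X → ℝ) : ∑ s, bernoulliWeight f s = 1 := by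
  unfold bernoulliWeight
  rw [← Fintype.prod_sum (fun x (b : Bool) => if b then f x else 1 - f x)]
  simp

theorem sum_bernoulliWeight_mul_eq_zero [DecidableEq X] (f : X → ℝ) {a b c d : X}
    (hb : a ≠ b) (hc : a ≠ c) (hd : a ≠ d) :
    ∑ s, bernoulliWeight f s * (roundingError f s a * roundingError f s b *
      roundingError f s c * roundingError f s d) = 0 := by
  let e : X → Bool → ℝ := fun x v => f x - if v then 1 else 0
  let F : X → Bool → ℝ := fun x v => (if v then f x else 1 - f x) *
    ((if x = a then e x v else 1) * (if x = b then e x v else 1) *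
      (if x = c then e x v else 1) * (if x = d then e x v else 1))
  have h : ∀ s : X → Bool, bernoulliWeight f s * (roundingError f s a * roundingError f s b *
      roundingError f s c * roundingError f s d) = ∏ x, F x (s x) := fun s => by
    simp only [F, e, Finset.prod_mul_distrib, Finset.prod_ite_eq', Finset.mem_univ, if_true,
      bernoulliWeight, roundingError]
  rw [Finset.sum_congr rfl fun s _ => h s, ← Fintype.prod_sum F]
  refine Finset.prod_eq_zero (Finset.mem_univ a) ?_
  simp only [F, e, Fintype.sum_bool, hb, hc, hd, if_true, if_false]
  simp
  ring

theorem sum_bernoulliWeight_mul_le_one [DecidableEq X] (hf : ∀ x, f x ∈ Set.Icc (0 : ℝ) 1)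
    (a b c d : X) :
    ∑ s, bernoulliWeight f s * (roundingError f s a * roundingError f s b *
      roundingError f s c * roundingError f s d) ≤ 1 := by
  rw [← sum_bernoulliWeight f]
  refine Finset.sum_le_sum fun s _ => mul_le_of_le_one_right (bernoulliWeight_nonneg hf s) ?_
  refine (le_abs_self _).trans ?_
  simp only [abs_mul]
  have h := abs_roundingError_le_one hf s
  exact mul_le_one₀ (mul_le_one₀ (mul_le_one₀ (h a) (abs_nonneg _) (h b)) (abs_nonneg _) (h c))
    (abs_nonneg _) (h d)

end Rounding

theorem card_degenerate_le {G : Type*} [AddCommGroup G] [Fintype G] [DecidableEq G] :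
    (Finset.univ.filter fun z : Fin 4 → G =>
      z 2 = z 3 ∨ z 0 = z 1 ∨ z 0 + z 2 = z 1 + z 3).card ≤ 3 * Fintype.card G ^ 3 := by
  have key : ∀ (P : (Fin 4 → G) → Prop) [DecidablePred P] (φ : (Fin 4 → G) → G × G × G),
      (∀ z w, P z → P w → φ z = φ w → z = w) →
        (Finset.univ.filter P).card ≤ Fintype.card G ^ 3 := by
    intro P _ φ h
    have := Finset.card_le_card_of_injOn (s := Finset.univ.filter P) (t := Finset.univ) φ
      (fun _ _ => Finset.mem_coe.2 (Finset.mem_univ _))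
      (fun z hz w hw => h z w (by simpa using hz) (by simpa using hw))
    refine this.trans (le_of_eq ?_)
    simp only [Finset.card_univ, Fintype.card_prod]
    ring
  have h₁ := key (fun z => z 2 = z 3) (fun z => (z 0, z 1, z 3)) fun z w hz hw h => by
    simp only [Prod.mk.injEq] at h
    ext i; fin_cases i <;> simp_all
  have h₂ := key (fun z => z 0 = z 1) (fun z => (z 1, z 2, z 3)) fun z w hz hw h => by
    simp only [Prod.mk.injEq] at h
    ext i; fin_cases i <;> simp_all
  have h₃ := key (fun z => z 0 + z 2 = z 1 + z 3) (fun z => (z 1, z 2, z 3)) fun z w hz hw h => by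
    simp only [Prod.mk.injEq] at h
    have h0 : z 0 = w 0 := by
      rw [eq_sub_of_add_eq hz, eq_sub_of_add_eq hw, h.1, h.2.1, h.2.2]
    ext i; fin_cases i <;> simp_all
  rw [Finset.filter_or, Finset.filter_or]
  have := Finset.card_union_le (Finset.univ.filter fun z : Fin 4 → G => z 2 = z 3)
    ((Finset.univ.filter fun z : Fin 4 → G => z 0 = z 1) ∪
      (Finset.univ.filter fun z : Fin 4 → G => z 0 + z 2 = z 1 + z 3))
  have := Finset.card_union_le (Finset.univ.filter fun z : Fin 4 → G => z 0 = z 1)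
      (Finset.univ.filter fun z : Fin 4 → G => z 0 + z 2 = z 1 + z 3)
  lia

theorem sum_bernoulliWeight_mul_parallelogramSum_le {G : Type*} [AddCommGroup G] [Fintype G]
    [DecidableEq G] {f : G → ℝ} (hf : ∀ x, f x ∈ Set.Icc (0 : ℝ) 1) :
    ∑ s, bernoulliWeight f s * parallelogramSum (roundingError f s) ≤
      3 * (Fintype.card G : ℝ) ^ 3 := by
  simp only [parallelogramSum, Finset.mul_sum]
  rw [Finset.sum_comm]
  calc _ ≤ ∑ z : Fin 4 → G,
        if z 2 = z 3 ∨ z 0 = z 1 ∨ z 0 + z 2 = z 1 + z 3 then (1 : ℝ) else 0 := by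
        refine Finset.sum_le_sum fun z _ => ?_
        split_ifs with h
        · exact sum_bernoulliWeight_mul_le_one hf _ _ _ _
        · push Not at h
          exact (sum_bernoulliWeight_mul_eq_zero f (by simpa using h.1) (by simpa using h.2.1)
            h.2.2).le
    _ ≤ 3 * (Fintype.card G : ℝ) ^ 3 := by
        rw [Finset.sum_boole]
        exact_mod_cast card_degenerate_le

theorem exists_parallelogramSum_roundingError_le {G : Type*} [AddCommGroup G] [Fintype G]
    {f : G → ℝ} (hf : ∀ x, f x ∈ Set.Icc (0 : ℝ) 1) :
    ∃ s, parallelogramSum (roundingError f s) ≤ 3 * (Fintype.card G : ℝ) ^ 3 := by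
  classical
  by_contra! h
  obtain ⟨s₀, hs₀⟩ : ∃ s, 0 < bernoulliWeight f s := by
    by_contra! hw
    linarith [sum_bernoulliWeight f, Finset.sum_nonpos fun s (_ : s ∈ Finset.univ) => hw s]
  refine (sum_bernoulliWeight_mul_parallelogramSum_le hf).not_gt ?_
  calc 3 * (Fintype.card G : ℝ) ^ 3
      = ∑ s, bernoulliWeight f s * (3 * (Fintype.card G : ℝ) ^ 3) := by
        rw [← Finset.sum_mul, sum_bernoulliWeight, one_mul]
    _ < _ := Finset.sum_lt_sum
        (fun s _ => mul_le_mul_of_nonneg_left (h s).le (bernoulliWeight_nonneg hf s))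
        ⟨s₀, Finset.mem_univ _, mul_lt_mul_of_pos_left (h s₀) hs₀⟩

/-- any `[0,1]`-valued function on `ℤ/p`, `p` a large enough prime,
is close in the `U²` norm to the indicator function of a set. -/
theorem stmt14 (ε : ℝ) (hε : 0 < ε) :
    ∃ P : ℕ, ∀ (p : ℕ) [NeZero p], p.Prime → P ≤ p →
      ∀ f : ZMod p → ℝ, (∀ x, f x ∈ Set.Icc (0 : ℝ) 1) →
        ∃ A : Set (ZMod p),
          U2Z (fun x => (f x : ℂ) - Set.indicator A (fun _ => (1 : ℂ)) x) ≤ ε := by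
  refine ⟨⌈3 / ε ^ 4⌉₊, fun p _ hp hP f hf => ?_⟩
  obtain ⟨s, hs⟩ := exists_parallelogramSum_roundingError_le hf
  rw [ZMod.card] at hs
  have hp0 : (0 : ℝ) < p := by exact_mod_cast hp.pos
  have hbound : parallelogramSum (roundingError f s) / (p : ℝ) ^ 4 ≤ ε ^ 4 := by
    have h := Nat.ceil_le.1 hP
    rw [div_le_iff₀ (by positivity)] at h ⊢
    calc _ ≤ 3 * (p : ℝ) ^ 3 := hs
      _ ≤ (p * ε ^ 4) * (p : ℝ) ^ 3 := by gcongr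
      _ = _ := by ring
  refine ⟨{x | s x = true}, ?_⟩
  have hfun : (fun x => (f x : ℂ) - Set.indicator {x | s x = true} (fun _ => (1 : ℂ)) x) =
      fun x => (roundingError f s x : ℂ) := by
    ext x
    by_cases hx : s x = true <;> simp [roundingError, Set.indicator, hx]
  rw [hfun, U2Z_ofReal]
  calc _ ≤ (ε ^ 4) ^ ((1 : ℝ) / 4) := Real.rpow_le_rpow
        (div_nonneg (parallelogramSum_nonneg _) (by positivity)) hbound (by norm_num)
    _ = ε := by
        rw [← Real.rpow_natCast, ← Real.rpow_mul hε.le]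
        norm_num
end
end

section
/- Let t ≥ 3 and let N be a positive integer. Suppose A₁,…,A_t ⊆ 𝕋 are each a union of intervals [(j−1)/N, j/N), j ∈ {1,…,N}, and define A_i' ⊆ ℤ/N by: j mod N ∈ A_i' if and only if [j/N, (j+1)/N) ⊆ A_i (for j ∈ {0,…,N−1}). Define T(B₁,…,B_t) = ∫_{𝕋^{t−1}} 1_{B₁}(x₁)⋯1_{B_{t−1}}(x_{t−1}) · 1_{B_t}(x₁+⋯+x_{t−1}) dx₁⋯dx_{t−1} for measurable B_i ⊆ 𝕋, and T'(C₁,…,C_t) = N^{−(t−1)} · |{(a₁,…,a_{t−1}) ∈ C₁×⋯×C_{t−1} : a₁+⋯+a_{t−1} ∈ C_t}| for C_i ⊆ ℤ/N. Then T(A₁,…,A_t) = (1/(t−1)!) · ∑_{r=0}^{t−2} E(t−1, r) · T'(A₁',…,A_{t−1}', A_t' − r), where E(n,k) is the Eulerian number, i.e. the number of permutations (a₁,…,a_n) of {1,…,n} with exactly k indices i ∈ {1,…,n−1} satisfying a_i < a_{i+1}. -/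
open MeasureTheory
noncomputable section

/-- The Eulerian number `E(n,k)`: the number of permutations `(a₁, …, a_n)` of
`{1, …, n}` with exactly `k` indices `i ∈ {1, …, n-1}` such that `a_i < a_{i+1}`. -/
def eulerian (n k : ℕ) : ℕ :=
  Nat.card {σ : Equiv.Perm (Fin n) //
    Nat.card {i : Fin n // ∃ h : (i : ℕ) + 1 < n, σ i < σ ⟨(i : ℕ) + 1, h⟩} = k}

/-- The interval `[j/N, (j+1)/N)` viewed inside the circle `ℝ/ℤ`. -/
def dyadInt (N j : ℕ) : Set UnitAddCircle :=
  (fun r : ℝ => (r : UnitAddCircle)) '' Set.Ico ((j : ℝ) / N) (((j : ℝ) + 1) / N)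

/-- `T(B₁, …, B_{s+1}) = ∫_{𝕋^s} 1_{B₁}(x₁)⋯1_{B_s}(x_s) 1_{B_{s+1}}(x₁+⋯+x_s) dx`. -/
def Tcirc {s : ℕ} (B : Fin (s + 1) → Set UnitAddCircle) : ℝ :=
  ∫ x : Fin s → UnitAddCircle,
    (∏ i : Fin s, Set.indicator (B i.castSucc) (fun _ => (1 : ℝ)) (x i)) *
      Set.indicator (B (Fin.last s)) (fun _ => (1 : ℝ)) (∑ i, x i)

/-- `T'(C₁, …, C_{s+1}) = N^{-s} |{a ∈ C₁ × ⋯ × C_s : a₁ + ⋯ + a_s ∈ C_{s+1}}|`. -/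
def Tdisc {N : ℕ} {s : ℕ} (C : Fin (s + 1) → Set (ZMod N)) : ℝ :=
  (Nat.card {a : Fin s → ZMod N //
      (∀ i, a i ∈ C i.castSucc) ∧ (∑ i, a i) ∈ C (Fin.last s)} : ℝ) / (N : ℝ) ^ s

/-- The representative in `[0, 1)` of a point of the circle. -/
def circleRep (x : UnitAddCircle) : ℝ := (AddCircle.equivIco 1 0 x : ℝ)

lemma circleRep_nonneg (x : UnitAddCircle) : 0 ≤ circleRep x :=
  (AddCircle.equivIco 1 0 x).2.1

lemma circleRep_lt_one (x : UnitAddCircle) : circleRep x < 1 :=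
  (AddCircle.equivIco 1 0 x).2.2.trans_eq (zero_add 1)

lemma coe_circleRep (x : UnitAddCircle) : ((circleRep x : ℝ) : UnitAddCircle) = x :=
  AddCircle.coe_equivIco

lemma circleRep_injective : Function.Injective circleRep :=
  Function.LeftInverse.injective coe_circleRep

lemma circleRep_coe_of_mem {u : ℝ} (h0 : 0 ≤ u) (h1 : u < 1) :
    circleRep (u : UnitAddCircle) = u :=
  AddCircle.equivIco_coe_of_mem ⟨h0, by simpa using h1⟩

lemma measurable_circleRep : Measurable circleRep :=
  measurable_subtype_coe.comp (AddCircle.measurableEquivIco 1 0).measurable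

lemma circleRep_zero : circleRep 0 = 0 :=
  circleRep_coe_of_mem le_rfl one_pos

lemma circleRep_sub (x y : UnitAddCircle) :
    circleRep (x - y) =
      circleRep x - circleRep y + if circleRep x < circleRep y then 1 else 0 := by
  have hx0 := circleRep_nonneg x
  have hx1 := circleRep_lt_one x
  have hy0 := circleRep_nonneg y
  have hy1 := circleRep_lt_one y
  have h : ((circleRep x - circleRep y + if circleRep x < circleRep y then 1 else 0 : ℝ) :
      UnitAddCircle) = x - y := by
    split_ifs <;> simp [coe_circleRep]
  rw [← h]
  apply circleRep_coe_of_mem <;> split_ifs <;> linarith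

/-- The number of ascents of a finite sequence. -/
def numAscents {n : ℕ} {α : Type*} [LT α] (f : Fin n → α) : ℕ :=
  Nat.card {i : Fin n // ∃ h : (i : ℕ) + 1 < n, f i < f ⟨(i : ℕ) + 1, h⟩}

lemma eulerian_eq (n k : ℕ) :
    eulerian n k = Nat.card {σ : Equiv.Perm (Fin n) // numAscents σ = k} := rfl

lemma numAscents_congr {n : ℕ} {α β : Type*} [LT α] [LT β] {f : Fin n → α} {g : Fin n → β}
    (h : ∀ i j, f i < f j ↔ g i < g j) : numAscents f = numAscents g := by
  simp only [numAscents, h]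

lemma card_perm_numAscents_comp {n : ℕ} {α : Type*} [LinearOrder α] {v : Fin n → α}
    (hv : Function.Injective v) (k : ℕ) :
    Nat.card {τ : Equiv.Perm (Fin n) // numAscents (v ∘ τ) = k} = eulerian n k := by
  have hm : StrictMono (v ∘ Tuple.sort v) :=
    (Tuple.monotone_sort v).strictMono_of_injective (hv.comp (Tuple.sort v).injective)
  rw [eulerian_eq]
  refine Nat.card_congr ((Equiv.mulLeft (Tuple.sort v)⁻¹).subtypeEquiv fun τ => ?_)
  rw [numAscents_congr (f := v ∘ τ) (g := ⇑(Equiv.mulLeft (Tuple.sort v)⁻¹ τ))]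
  intro i j
  rw [← hm.lt_iff_lt]
  simp

/-- Consecutive differences `(y₀ - y₁, y₁ - y₂, …, yₙ₋₁)` on the torus. -/
def torusDiff (n : ℕ) : (Fin n → UnitAddCircle) →+ (Fin n → UnitAddCircle) where
  toFun y i := y i - if h : (i : ℕ) + 1 < n then y ⟨i + 1, h⟩ else 0
  map_zero' := by ext i; simp
  map_add' y z := by
    ext i
    by_cases h : (i : ℕ) + 1 < n
    · simp only [Pi.add_apply, h, dite_true]; abel
    · simp [h]

lemma torusDiff_surjective (n : ℕ) : Function.Surjective (torusDiff n) := by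
  intro x
  let X : ℕ → UnitAddCircle := fun k => if h : k < n then x ⟨k, h⟩ else 0
  refine ⟨fun i => ∑ j ∈ Finset.Ico (i : ℕ) n, X j, ?_⟩
  ext i
  have hX : X i = x i := by simp [X]
  change (∑ j ∈ Finset.Ico (i : ℕ) n, X j) - (if h : (i : ℕ) + 1 < n then _ else 0) = _
  rw [Finset.sum_eq_sum_Ico_succ_bot i.2, hX]
  split_ifs with h
  · simp
  · rw [Finset.Ico_eq_empty (by omega)]; simp

lemma continuous_torusDiff (n : ℕ) : Continuous (torusDiff n) := by
  refine continuous_pi fun i => ?_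
  change Continuous fun y : Fin n → UnitAddCircle =>
    y i - if h : (i : ℕ) + 1 < n then y ⟨i + 1, h⟩ else 0
  split_ifs <;> fun_prop

lemma measurePreserving_torusDiff (n : ℕ) : MeasurePreserving (torusDiff n) :=
  AddMonoidHom.measurePreserving (continuous_torusDiff n) (torusDiff_surjective n) rfl

lemma sum_circleRep_torusDiff {n : ℕ} (y : Fin (n + 1) → UnitAddCircle) :
    ∑ i, circleRep (torusDiff (n + 1) y i) =
      circleRep (y 0) + numAscents fun i => circleRep (y i) := by
  classical
  let w : ℕ → ℝ := fun k => if h : k < n + 1 then circleRep (y ⟨k, h⟩) else 0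
  have key : ∀ i : Fin (n + 1), circleRep (torusDiff (n + 1) y i) = (w i - w (i + 1)) +
      if ∃ h : (i : ℕ) + 1 < n + 1, circleRep (y i) < circleRep (y ⟨i + 1, h⟩)
        then 1 else 0 := by
    intro i
    change circleRep (y i - if h : (i : ℕ) + 1 < n + 1 then y ⟨i + 1, h⟩ else 0) = _
    rw [circleRep_sub]
    by_cases h : (i : ℕ) + 1 < n + 1
    · simp only [h, dite_true, w, i.2, exists_true_left]
    · simp only [h, dite_false, w, i.2, dite_true, circleRep_zero,
        (circleRep_nonneg (y i)).not_gt, if_false, IsEmpty.exists_iff]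
  rw [Finset.sum_congr rfl fun i _ => key i, Finset.sum_add_distrib,
    Fin.sum_univ_eq_sum_range (fun k => w k - w (k + 1)), Finset.sum_range_sub',
    Finset.sum_boole, numAscents, Nat.card_eq_fintype_card, Fintype.card_subtype]
  simp [w]

lemma floor_sum_circleRep_torusDiff {n : ℕ} (hn : 0 < n) (y : Fin n → UnitAddCircle) :
    ⌊∑ i, circleRep (torusDiff n y i)⌋₊ = numAscents fun i => circleRep (y i) := by
  obtain ⟨n, rfl⟩ : ∃ m, n = m + 1 := ⟨n - 1, by omega⟩
  rw [sum_circleRep_torusDiff, Nat.floor_add_natCast (circleRep_nonneg _),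
    Nat.floor_eq_zero.2 (circleRep_lt_one _), zero_add]

lemma volume_torus_univ (n : ℕ) : volume (Set.univ : Set (Fin n → UnitAddCircle)) = 1 := by
  rw [volume_pi, Measure.pi_univ]
  simp

lemma volume_torus_eq {n : ℕ} {i j : Fin n} (hij : i ≠ j) :
    volume {y : Fin n → UnitAddCircle | y i = y j} = 0 := by
  let f : (Fin n → UnitAddCircle) →+ UnitAddCircle :=
    Pi.evalAddMonoidHom (fun _ => UnitAddCircle) i -
      Pi.evalAddMonoidHom (fun _ => UnitAddCircle) j
  have hf : MeasurePreserving f := by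
    refine AddMonoidHom.measurePreserving ?_ ?_ ?_
    · change Continuous fun y : Fin n → UnitAddCircle => y i - y j
      fun_prop
    · intro x
      refine ⟨Pi.single i x, ?_⟩
      simp [f, hij.symm]
    · rw [volume_torus_univ, UnitAddCircle.measure_univ]
  have h := hf.measure_preimage (measurableSet_singleton 0).nullMeasurableSet
  rw [show volume ({0} : Set UnitAddCircle) = 0 from ?_] at h
  · rw [← h]
    congr 1
    ext y
    simp [f, sub_eq_zero]
  · simpa using AddCircle.volume_closedBall (T := 1) (x := 0) 0

lemma ae_injective_torus (n : ℕ) : ∀ᵐ y : Fin n → UnitAddCircle, Function.Injective y := by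
  have h : ∀ᵐ y : Fin n → UnitAddCircle, ∀ i j, i ≠ j → y i ≠ y j := by
    simp only [ae_all_iff]
    intro i j hij
    simpa [ae_iff] using volume_torus_eq hij
  filter_upwards [h] with y hy i j hij
  by_contra hne
  exact hy i j hne hij

lemma measurePreserving_torus_perm {n : ℕ} (τ : Equiv.Perm (Fin n)) :
    MeasurePreserving fun y : Fin n → UnitAddCircle => y ∘ τ := by
  let f : (Fin n → UnitAddCircle) →+ (Fin n → UnitAddCircle) :=
    { toFun := fun y => y ∘ τ, map_zero' := rfl, map_add' := fun _ _ => rfl }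
  refine AddMonoidHom.measurePreserving (f := f) ?_ ?_ rfl
  · change Continuous fun y : Fin n → UnitAddCircle => y ∘ τ
    fun_prop
  · intro x
    exact ⟨x ∘ τ.symm, by ext i; simp [f]⟩

lemma measurableSet_floor_sum_circleRep (n k : ℕ) :
    MeasurableSet {x : Fin n → UnitAddCircle | ⌊∑ i, circleRep (x i)⌋₊ = k} := by
  have : Measurable fun x : Fin n → UnitAddCircle => ⌊∑ i, circleRep (x i)⌋₊ :=
    Nat.measurable_floor.comp
      (Finset.measurable_sum _ fun i _ => measurable_circleRep.comp (measurable_pi_apply i))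
  exact this (measurableSet_singleton k)

lemma volume_real_floor_sum_circleRep {n : ℕ} (hn : 0 < n) (k : ℕ) :
    volume.real {x : Fin n → UnitAddCircle | ⌊∑ i, circleRep (x i)⌋₊ = k} =
      eulerian n k / n.factorial := by
  classical
  set W : Set (Fin n → UnitAddCircle) := {y | numAscents (fun i => circleRep (y i)) = k} with hW
  have hpre : W = torusDiff n ⁻¹' {x | ⌊∑ i, circleRep (x i)⌋₊ = k} := by
    ext y
    simp only [hW, Set.mem_ofPred_eq, Set.mem_preimage, floor_sum_circleRep_torusDiff hn]
  have hWm : MeasurableSet W := by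
    rw [hpre]
    exact (measurePreserving_torusDiff n).measurable (measurableSet_floor_sum_circleRep n k)
  have h1 : volume.real {x : Fin n → UnitAddCircle | ⌊∑ i, circleRep (x i)⌋₊ = k} =
      volume.real W := by
    rw [hpre, (measurePreserving_torusDiff n).measureReal_preimage
      (measurableSet_floor_sum_circleRep n k).nullMeasurableSet]
  have h2 : ∀ τ : Equiv.Perm (Fin n),
      ∫ y : Fin n → UnitAddCircle, W.indicator (fun _ => (1 : ℝ)) (y ∘ τ) = volume.real W := by
    intro τ
    have hp := measurePreserving_torus_perm τ
    have h := integral_indicator_one (μ := volume) (hp.measurable hWm)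
    rw [hp.measureReal_preimage hWm.nullMeasurableSet] at h
    rw [← h]
    rfl
  have h3 : ∑ τ : Equiv.Perm (Fin n),
      ∫ y : Fin n → UnitAddCircle, W.indicator (fun _ => (1 : ℝ)) (y ∘ τ) = eulerian n k := by
    rw [← integral_finsetSum]
    · have : ∀ᵐ y : Fin n → UnitAddCircle,
          ∑ τ : Equiv.Perm (Fin n), W.indicator (fun _ => (1 : ℝ)) (y ∘ τ) = eulerian n k := by
        filter_upwards [ae_injective_torus n] with y hy
        rw [← card_perm_numAscents_comp (circleRep_injective.comp hy) k,
          Nat.card_eq_fintype_card, Fintype.card_subtype, ← Finset.sum_boole]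
        refine Finset.sum_congr rfl fun τ _ => ?_
        rw [Set.indicator_apply]
        rfl
      rw [integral_congr_ae this]
      simp [measureReal_def, volume_torus_univ]
    · intro τ _
      exact (integrable_const (1 : ℝ)).indicator
        ((measurePreserving_torus_perm τ).measurable hWm)
  simp only [h2, Finset.sum_const, Finset.card_univ, Fintype.card_perm, Fintype.card_fin,
    nsmul_eq_mul] at h3
  rw [h1, eq_div_iff (by positivity), mul_comm, h3]

/-- The uniform probability measure on `ℤ/N`. -/
def zmodUniform (N : ℕ) : Measure (ZMod N) := (N : ENNReal)⁻¹ • Measure.count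

instance isProbabilityMeasure_zmodUniform (N : ℕ) [NeZero N] :
    IsProbabilityMeasure (zmodUniform N) := by
  constructor
  simp [zmodUniform, Measure.count_univ, ENat.card_eq_coe_fintype_card, ZMod.card,
    ENNReal.inv_mul_cancel, NeZero.ne N]

/-- The point of the circle at relative position `w` in the `a`-th interval of the grid of
mesh `1/N`. -/
def gridPoint (N : ℕ) (p : ZMod N × UnitAddCircle) : UnitAddCircle :=
  (((p.1.val + circleRep p.2) / N : ℝ) : UnitAddCircle)

lemma measurable_gridPoint (N : ℕ) : Measurable (gridPoint N) := by
  have h1 : Measurable fun p : ZMod N × UnitAddCircle => (p.1.val : ℝ) :=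
    (measurable_from_top (f := fun a : ZMod N => (a.val : ℝ))).comp measurable_fst
  exact AddCircle.measurable_mk'.comp
    ((h1.add (measurable_circleRep.comp measurable_snd)).div_const _)

lemma measurePreserving_circleRep :
    MeasurePreserving circleRep volume (volume.restrict (Set.Ico 0 1)) := by
  refine ⟨measurable_circleRep, ?_⟩
  have hmk := UnitAddCircle.measurePreserving_mk 0
  rw [zero_add, ← restrict_Ico_eq_restrict_Ioc] at hmk
  rw [← hmk.map_eq, Measure.map_map measurable_circleRep hmk.measurable]
  conv_rhs => rw [← Measure.map_id (μ := volume.restrict (Set.Ico (0 : ℝ) 1))]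
  refine Measure.map_congr ?_
  filter_upwards [ae_restrict_mem measurableSet_Ico] with u hu
  exact circleRep_coe_of_mem hu.1 hu.2

lemma mem_Ico_grid_iff {N : ℕ} (hN : 0 < N) (a : ℕ) (x : ℝ) :
    x ∈ Set.Ico ((a : ℝ) / N) ((a + 1) / N) ↔ 0 ≤ x ∧ ⌊x * N⌋₊ = a := by
  have hN' : (0 : ℝ) < N := by exact_mod_cast hN
  rw [Set.mem_Ico, div_le_iff₀ hN', lt_div_iff₀ hN']
  constructor
  · rintro ⟨h1, h2⟩
    have h0 : 0 ≤ x * N := le_trans (Nat.cast_nonneg a) h1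
    exact ⟨nonneg_of_mul_nonneg_left h0 hN', (Nat.floor_eq_iff h0).2 ⟨h1, h2⟩⟩
  · rintro ⟨h0, h⟩
    exact (Nat.floor_eq_iff (by positivity)).1 h

lemma volume_preimage_grid {N : ℕ} (hN : 0 < N) (a : ℝ) (E : Set ℝ) :
    volume ((fun u : ℝ => (a + u) / N) ⁻¹' E) = N * volume E := by
  have hN' : (N : ℝ) ≠ 0 := by exact_mod_cast hN.ne'
  have h : (fun u : ℝ => (a + u) / N) ⁻¹' E =
      (fun u => a + u) ⁻¹' ((fun u => (N : ℝ)⁻¹ * u) ⁻¹' E) := by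
    ext u
    simp [div_eq_inv_mul]
  rw [h, measure_preimage_add, Real.volume_preimage_mul_left (inv_ne_zero hN')]
  simp

lemma measurePreserving_gridPoint (N : ℕ) [NeZero N] :
    MeasurePreserving (gridPoint N) ((zmodUniform N).prod volume) volume := by
  have hN : 0 < N := Nat.pos_of_neZero N
  have hN' : (0 : ℝ) < N := by exact_mod_cast hN
  refine ⟨measurable_gridPoint N, Measure.ext fun E hE => ?_⟩
  have hmk := UnitAddCircle.measurePreserving_mk 0
  rw [zero_add, ← restrict_Ico_eq_restrict_Ioc] at hmk
  set F : Set ℝ := (fun u : ℝ => (u : UnitAddCircle)) ⁻¹' E with hF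
  have hFm : MeasurableSet F := hmk.measurable hE
  have hslice : ∀ a : ZMod N, volume (Prod.mk a ⁻¹' (gridPoint N ⁻¹' E)) =
      N * volume (F ∩ Set.Ico ((a.val : ℝ) / N) ((a.val + 1) / N)) := by
    intro a
    have hm : Measurable fun u : ℝ => ((a.val : ℝ) + u) / N := by fun_prop
    have h1 : Prod.mk a ⁻¹' (gridPoint N ⁻¹' E) =
        circleRep ⁻¹' ((fun u : ℝ => ((a.val : ℝ) + u) / N) ⁻¹' F) := rfl
    rw [h1, measurePreserving_circleRep.measure_preimage (hm hFm).nullMeasurableSet,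
      Measure.restrict_apply (hm hFm), ← volume_preimage_grid hN a.val]
    congr 1
    ext u
    simp only [Set.mem_inter_iff, Set.mem_preimage, Set.mem_Ico]
    rw [div_le_div_iff_of_pos_right hN', div_lt_div_iff_of_pos_right hN']
    simp
  have hunion : F ∩ Set.Ico 0 1 =
      ⋃ a : ZMod N, F ∩ Set.Ico ((a.val : ℝ) / N) ((a.val + 1) / N) := by
    ext x
    simp only [Set.mem_inter_iff, Set.mem_iUnion, mem_Ico_grid_iff hN, Set.mem_Ico]
    constructor
    · rintro ⟨hx, h0, h1⟩
      have hlt : ⌊x * N⌋₊ < N := by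
        rw [Nat.floor_lt (by positivity)]
        nlinarith
      exact ⟨(⌊x * N⌋₊ : ZMod N), hx, h0, (ZMod.val_cast_of_lt hlt).symm⟩
    · rintro ⟨a, hx, h0, h1⟩
      refine ⟨hx, h0, ?_⟩
      have h2 : ⌊x * N⌋₊ < N := h1 ▸ a.val_lt
      rw [Nat.floor_lt (by positivity)] at h2
      nlinarith
  have hdisj : Pairwise (Function.onFun Disjoint fun a : ZMod N =>
      F ∩ Set.Ico ((a.val : ℝ) / N) ((a.val + 1) / N)) := by
    intro a b hab
    refine Set.disjoint_left.2 fun x hxa hxb => hab ?_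
    have h1 := ((mem_Ico_grid_iff hN _ _).1 hxa.2).2
    have h2 := ((mem_Ico_grid_iff hN _ _).1 hxb.2).2
    exact ZMod.val_injective N (h1.symm.trans h2)
  rw [Measure.map_apply (measurable_gridPoint N) hE,
    Measure.prod_apply (measurable_gridPoint N hE), zmodUniform, lintegral_smul_measure,
    lintegral_count, ← hmk.measure_preimage hE.nullMeasurableSet,
    Measure.restrict_apply hFm, hunion,
    measure_iUnion hdisj fun a => hFm.inter measurableSet_Ico]
  simp only [hslice]
  rw [ENNReal.tsum_mul_left, smul_eq_mul, ← mul_assoc, ENNReal.inv_mul_cancel, one_mul]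
  · simpa using hN.ne'
  · simp

lemma gridPoint_natCast {N : ℕ} (hN : 0 < N) (k : ℕ) (w : UnitAddCircle) :
    gridPoint N ((k : ZMod N), w) = (((k + circleRep w) / N : ℝ) : UnitAddCircle) := by
  have hN' : (N : ℝ) ≠ 0 := by exact_mod_cast hN.ne'
  have hk : (k : ℝ) = (k % N : ℕ) + N * (k / N : ℕ) := by exact_mod_cast (Nat.mod_add_div k N).symm
  have h : ((k + circleRep w) / N : ℝ) =
      ((k % N : ℕ) + circleRep w) / N + (k / N : ℕ) := by
    rw [div_add' _ _ _ hN', hk]; ring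
  have h0 : (((k / N : ℕ) : ℝ) : UnitAddCircle) = 0 := by
    rw [AddCircle.coe_eq_zero_iff]
    exact ⟨((k / N : ℕ) : ℤ), by rw [zsmul_one, Int.cast_natCast]⟩
  rw [h, AddCircle.coe_add, h0, add_zero, gridPoint, ZMod.val_natCast]

lemma sum_gridPoint {N s : ℕ} [NeZero N] (a : Fin s → ZMod N) (w : Fin s → UnitAddCircle) :
    ∃ v : UnitAddCircle, ∑ i, gridPoint N (a i, w i) =
      gridPoint N (∑ i, a i + (⌊∑ i, circleRep (w i)⌋₊ : ZMod N), v) := by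
  set U : ℝ := ∑ i, circleRep (w i) with hU
  have hU0 : 0 ≤ U := Finset.sum_nonneg fun i _ => circleRep_nonneg _
  have hrep : circleRep ((U - ⌊U⌋₊ : ℝ) : UnitAddCircle) = U - ⌊U⌋₊ :=
    circleRep_coe_of_mem (sub_nonneg.2 (Nat.floor_le hU0)) (by linarith [Nat.lt_floor_add_one U])
  refine ⟨((U - ⌊U⌋₊ : ℝ) : UnitAddCircle), ?_⟩
  have ha : ∑ i, a i + (⌊U⌋₊ : ZMod N) = ((∑ i, (a i).val + ⌊U⌋₊ : ℕ) : ZMod N) := by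
    simp
  rw [ha, gridPoint_natCast (Nat.pos_of_neZero N), hrep]
  have hs : ∑ i, gridPoint N (a i, w i) =
      ((∑ i, ((a i).val + circleRep (w i)) / N : ℝ) : UnitAddCircle) :=
    (map_sum (QuotientAddGroup.mk' (AddSubgroup.zmultiples (1 : ℝ))) _ _).symm
  rw [hs, ← Finset.sum_div, Finset.sum_add_distrib, ← hU]
  congr 2
  push_cast
  ring

lemma mem_dyadInt_iff {N : ℕ} (hN : 0 < N) {j : ℕ} (hj : j < N) (x : UnitAddCircle) :
    x ∈ dyadInt N j ↔ circleRep x ∈ Set.Ico ((j : ℝ) / N) ((j + 1) / N) := by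
  have hN' : (0 : ℝ) < N := by exact_mod_cast hN
  constructor
  · rintro ⟨u, hu, rfl⟩
    have h0 : 0 ≤ u := le_trans (by positivity) hu.1
    have h1 : u < 1 := hu.2.trans_le ((div_le_one hN').2 (by exact_mod_cast hj))
    simpa only [circleRep_coe_of_mem h0 h1] using hu
  · intro h
    exact ⟨_, h, coe_circleRep x⟩

lemma measurableSet_dyadInt {N : ℕ} (hN : 0 < N) {j : ℕ} (hj : j < N) :
    MeasurableSet (dyadInt N j) := by
  have : dyadInt N j = circleRep ⁻¹' Set.Ico ((j : ℝ) / N) ((j + 1) / N) :=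
    Set.ext (mem_dyadInt_iff hN hj)
  rw [this]
  exact measurable_circleRep measurableSet_Ico

lemma gridPoint_mem_dyadInt_iff {N : ℕ} [NeZero N] {j : ℕ} (hj : j < N) (a : ZMod N)
    (w : UnitAddCircle) : gridPoint N (a, w) ∈ dyadInt N j ↔ a.val = j := by
  have hN : 0 < N := Nat.pos_of_neZero N
  have hN' : (0 : ℝ) < N := by exact_mod_cast hN
  have h0 := circleRep_nonneg w
  have h1 := circleRep_lt_one w
  have ha : (a.val : ℝ) + 1 ≤ N := by exact_mod_cast a.val_lt
  rw [mem_dyadInt_iff hN hj, gridPoint, circleRep_coe_of_mem (by positivity)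
    ((div_lt_one hN').2 (by linarith)), mem_Ico_grid_iff hN, div_mul_cancel₀ _ hN'.ne',
    add_comm, Nat.floor_add_natCast h0, Nat.floor_eq_zero.2 h1, zero_add]
  exact and_iff_right (by positivity)

lemma gridPoint_mem_iff {N : ℕ} [NeZero N] {A : Set UnitAddCircle} {S : Finset (Fin N)}
    (hA : A = ⋃ j ∈ S, dyadInt N (j : ℕ)) {A' : Set (ZMod N)}
    (hA' : ∀ j : ℕ, j < N → (((j : ZMod N) ∈ A') ↔ dyadInt N j ⊆ A)) (a : ZMod N)
    (w : UnitAddCircle) : gridPoint N (a, w) ∈ A ↔ a ∈ A' := by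
  have h := hA' a.val a.val_lt
  rw [ZMod.natCast_zmod_val] at h
  rw [h]
  constructor
  · intro hm
    rw [hA] at hm
    simp only [Set.mem_iUnion] at hm
    obtain ⟨j, hj, hm⟩ := hm
    rw [(gridPoint_mem_dyadInt_iff j.2 a w).1 hm, hA]
    exact Set.subset_biUnion_of_mem (u := fun j : Fin N => dyadInt N (j : ℕ)) hj
  · intro hsub
    exact hsub ((gridPoint_mem_dyadInt_iff a.val_lt a w).2 rfl)

lemma measureReal_pi_zmodUniform {N s : ℕ} [NeZero N] (C : Set (Fin s → ZMod N)) :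
    (Measure.pi fun _ : Fin s => zmodUniform N).real C = Nat.card C / (N : ℝ) ^ s := by
  classical
  have hsing : ∀ a : Fin s → ZMod N,
      (Measure.pi fun _ : Fin s => zmodUniform N).real {a} = ((N : ℝ) ^ s)⁻¹ := by
    intro a
    rw [measureReal_def, Measure.pi_singleton]
    simp [zmodUniform]
  rw [← Set.coe_toFinset C, ← sum_measureReal_singleton]
  simp [hsing, div_eq_mul_inv]

/-- Volume of a set of the torus whose membership depends only on the grid cell and the integer
part of the sum of the relative positions. -/
lemma volume_real_torus_grid {N s : ℕ} [NeZero N] (hs : 0 < s)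
    {G : Set (Fin s → UnitAddCircle)} (hG : MeasurableSet G) (C : ℕ → Set (Fin s → ZMod N))
    (hC : ∀ (a : Fin s → ZMod N) (w : Fin s → UnitAddCircle), (fun i => gridPoint N (a i, w i)) ∈ G ↔
      a ∈ C ⌊∑ i, circleRep (w i)⌋₊) :
    volume.real G = ∑ r ∈ Finset.range s,
      Nat.card (C r) / (N : ℝ) ^ s * (eulerian s r / s.factorial) := by
  have h1 : MeasurePreserving
      (fun (p : Fin s → ZMod N × UnitAddCircle) i => gridPoint N (p i))
      (Measure.pi fun _ => (zmodUniform N).prod volume) volume :=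
    measurePreserving_pi _ _ fun _ => measurePreserving_gridPoint N
  have h2 := (measurePreserving_arrowProdEquivProdArrow (ZMod N) UnitAddCircle (Fin s)
    (fun _ => zmodUniform N) fun _ => volume).symm
  have h3 := h1.comp h2
  rw [← h3.measureReal_preimage hG.nullMeasurableSet]
  let W : ℕ → Set (Fin s → UnitAddCircle) := fun r => {w | ⌊∑ i, circleRep (w i)⌋₊ = r}
  have hset : ((fun (p : Fin s → ZMod N × UnitAddCircle) i => gridPoint N (p i)) ∘
      (MeasurableEquiv.arrowProdEquivProdArrow (ZMod N) UnitAddCircle (Fin s)).symm) ⁻¹' G =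
      ⋃ r ∈ Finset.range s, C r ×ˢ W r := by
    ext ⟨a, w⟩
    have hlt : ⌊∑ i, circleRep (w i)⌋₊ < s := by
      rw [Nat.floor_lt (Finset.sum_nonneg fun i _ => circleRep_nonneg _)]
      calc ∑ i, circleRep (w i) < ∑ _i : Fin s, (1 : ℝ) :=
            Finset.sum_lt_sum_of_nonempty ⟨⟨0, hs⟩, Finset.mem_univ _⟩
              fun i _ => circleRep_lt_one _
        _ = s := by simp
    refine (hC a w).trans ?_
    simp only [Set.mem_iUnion, Set.mem_prod, Finset.mem_range, W, Set.mem_ofPred_eq]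
    constructor
    · exact fun h => ⟨_, hlt, h, rfl⟩
    · rintro ⟨r, -, h, rfl⟩
      exact h
  rw [hset, measureReal_biUnion_finset]
  · refine Finset.sum_congr rfl fun r _ => ?_
    rw [measureReal_prod_prod, measureReal_pi_zmodUniform, ← volume_pi,
      volume_real_floor_sum_circleRep hs]
  · intro r _ r' _ hne
    refine Set.disjoint_left.2 fun p hp hp' => hne ?_
    exact hp.2.symm.trans hp'.2
  · intro r _
    exact (Set.toFinite _).measurableSet.prod (measurableSet_floor_sum_circleRep s r)

/-- the solution count on the circle for sets that are unions of
intervals `[(j-1)/N, j/N)`, in terms of Eulerian numbers and discrete solution counts.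
The form has `t = s + 1 ≥ 3` variables. -/
theorem stmt19 {s : ℕ} (hs : 2 ≤ s) (N : ℕ) (hN : 0 < N)
    (A : Fin (s + 1) → Set UnitAddCircle) (S : Fin (s + 1) → Finset (Fin N))
    (hA : ∀ i, A i = ⋃ j ∈ S i, dyadInt N (j : ℕ))
    (A' : Fin (s + 1) → Set (ZMod N))
    (hA' : ∀ i, ∀ j : ℕ, j < N → (((j : ZMod N) ∈ A' i) ↔ dyadInt N j ⊆ A i)) :
    Tcirc A = (1 / (Nat.factorial s) : ℝ) *
      ∑ r ∈ Finset.range s, (eulerian s r : ℝ) *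
        Tdisc (fun i => if i = Fin.last s
          then (fun x : ZMod N => x - (r : ZMod N)) '' A' i else A' i) := by
  classical
  have : NeZero N := ⟨hN.ne'⟩
  have hAm : ∀ i, MeasurableSet (A i) := fun i => by
    rw [hA i]
    exact Finset.measurableSet_biUnion _ fun j _ => measurableSet_dyadInt hN j.2
  set G : Set (Fin s → UnitAddCircle) :=
    {x | (∀ i, x i ∈ A i.castSucc) ∧ ∑ i, x i ∈ A (Fin.last s)} with hG
  have hGm : MeasurableSet G := by
    have h1 : MeasurableSet {x : Fin s → UnitAddCircle | ∀ i, x i ∈ A i.castSucc} := by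
      have : {x : Fin s → UnitAddCircle | ∀ i, x i ∈ A i.castSucc} =
          Set.univ.pi fun i => A i.castSucc := by ext; simp
      rw [this]
      exact MeasurableSet.univ_pi fun i => hAm _
    have h2 : Measurable fun x : Fin s → UnitAddCircle => ∑ i, x i := by fun_prop
    exact h1.inter (h2 (hAm _))
  have hT : Tcirc A = volume.real G := by
    rw [← integral_indicator_one hGm, Tcirc]
    refine integral_congr_ae (Filter.Eventually.of_forall fun x => ?_)
    simp only [Set.indicator_apply, Finset.prod_boole, Finset.mem_univ, true_imp_iff, hG,
      Set.mem_ofPred_eq, ← ite_and, mul_ite, mul_one, mul_zero, Pi.one_apply]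
    simp only [and_comm]
  let C : ℕ → Set (Fin s → ZMod N) := fun r =>
    {a | (∀ i, a i ∈ A' i.castSucc) ∧ ∑ i, a i + (r : ZMod N) ∈ A' (Fin.last s)}
  have hC : ∀ (a : Fin s → ZMod N) (w : Fin s → UnitAddCircle),
      (fun i => gridPoint N (a i, w i)) ∈ G ↔
      a ∈ C ⌊∑ i, circleRep (w i)⌋₊ := by
    intro a w
    obtain ⟨v, hv⟩ := sum_gridPoint a w
    simp only [hG, C, Set.mem_ofPred_eq, hv, gridPoint_mem_iff (hA _) (hA' _)]
  have hD : ∀ r : ℕ, Tdisc (fun i => if i = Fin.last s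
      then (fun x : ZMod N => x - (r : ZMod N)) '' A' i else A' i) =
      Nat.card (C r) / (N : ℝ) ^ s := by
    intro r
    rw [Tdisc]
    congr 2
    refine Nat.card_congr (Equiv.subtypeEquivRight fun a => ?_)
    simp [C, (Fin.castSucc_lt_last _).ne, sub_eq_iff_eq_add]
  rw [hT, volume_real_torus_grid (by omega) hGm C hC, Finset.mul_sum]
  refine Finset.sum_congr rfl fun r _ => ?_
  rw [hD]
  ring
end
end
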